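/- Fix a positive integer K, a set H, a colouring c assigning to every unordered pair of distinct elements of H a colour in {0,…,K−1}, a stationary set Λ ⊆ P_{ω1}(H), and a function F : Λ → H such that F(M) ∉ M for every M ∈ Λ. Then there exist a fine normal ideal I on P_{ω1}(H), a set A ⊆ Λ with A ∈ I⁺, a proper subset P ⊊ {0,…,K−1}×{0,…,K−1}, and a pair (i,j) ∈ ({0,…,K−1}×{0,…,K−1}) ∖ P such that: (1) for every fine normal ideal J ⊇ I and all C, D ⊆ A with C, D ∈ J⁺, if (C,D) is P-unsaturated over J then (C,D) is (i,j)-saturated over J; and (2) for every fine normal ideal J₀ ⊇ I and every B ⊆ A with B ∈ J₀⁺, there exist a fine normal ideal J₁ ⊇ J₀ and sets C, D ⊆ B with C, D ∈ J₁⁺ such that (C,D) is P-unsaturated over J₁. -/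

import Mathlib

namespace Galvin

/-- `P_{ω₁}(H)`: the collection of countable subsets of `H`. -/
def Pom (H : Type u) : Set (Set H) := {M : Set H | M.Countable}

/-- An ideal on `P_{ω₁}(H)`: a proper collection of subsets of `P_{ω₁}(H)` closed under
subsets and finite unions. -/
structure IsIdeal (H : Type u) (I : Set (Set (Set H))) : Prop where
  subset_pom : ∀ A ∈ I, A ⊆ Pom H
  empty_mem : (∅ : Set (Set H)) ∈ I
  subset_mem : ∀ A ∈ I, ∀ B : Set (Set H), B ⊆ A → B ∈ I
  union_mem : ∀ A ∈ I, ∀ B ∈ I, A ∪ B ∈ I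
  proper : Pom H ∉ I

/-- ℵ₁-completeness: closure under countable unions. -/
def IsComplete {H : Type u} (I : Set (Set (Set H))) : Prop :=
  ∀ A : ℕ → Set (Set H), (∀ n, A n ∈ I) → (⋃ n, A n) ∈ I

/-- A fine ideal: an ℵ₁-complete ideal containing `{M : x ∉ M}` for every `x ∈ H`. -/
def IsFineIdeal (H : Type u) (I : Set (Set (Set H))) : Prop :=
  IsIdeal H I ∧ IsComplete I ∧ ∀ x : H, {M ∈ Pom H | x ∉ M} ∈ I

/-- Normality: closure under diagonal unions. -/
def IsNormal (H : Type u) (I : Set (Set (Set H))) : Prop :=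
  ∀ A : H → Set (Set H), (∀ x, A x ∈ I) → {M ∈ Pom H | ∃ x ∈ M, M ∈ A x} ∈ I

/-- `I⁺`: the `I`-positive subsets of `P_{ω₁}(H)`. -/
def pos (H : Type u) (I : Set (Set (Set H))) : Set (Set (Set H)) :=
  {A | A ⊆ Pom H ∧ A ∉ I}

/-- `I*`: the dual filter of `I`. -/
def star (H : Type u) (I : Set (Set (Set H))) : Set (Set (Set H)) :=
  {A | Pom H \ A ∈ I}

/-- `I + A`: the ideal `{B : B ∩ A ∈ I}`. -/
def add (H : Type u) (I : Set (Set (Set H))) (A : Set (Set H)) : Set (Set (Set H)) :=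
  {B | B ⊆ Pom H ∧ B ∩ A ∈ I}

end Galvin
namespace Galvin

/-- `∃^I M ∈ A, φ(M)`: the set of `M ∈ A` with `φ(M)` is `(I+A)`-positive. -/
def eIdeal {H : Type u} (I : Set (Set (Set H))) (A : Set (Set H)) (φ : Set H → Prop) : Prop :=
  {M ∈ A | φ M} ∈ pos H (add H I A)

/-- `∀^I M ∈ A, φ(M)`: the set of `M ∈ A` with `φ(M)` is in the dual filter `(I+A)*`. -/
def aIdeal {H : Type u} (I : Set (Set (Set H))) (A : Set (Set H)) (φ : Set H → Prop) : Prop :=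
  {M ∈ A | φ M} ∈ star H (add H I A)

/-- `(A, B)` is weakly `(i,j)`-saturated over `I`. -/
def WeaklySat {H : Type u} {X : Type v} {K : ℕ} (c : Sym2 X → Fin K)
    (I : Set (Set (Set H))) (F : Set H → X) (A B : Set (Set H)) (i j : Fin K) : Prop :=
  eIdeal I A (fun M => eIdeal I B (fun N => F M ≠ F N ∧ c s(F M, F N) = i)) ∧
  eIdeal I B (fun N => eIdeal I A (fun M => F M ≠ F N ∧ c s(F M, F N) = j))

/-- `(A, B)` is `(i,j)`-saturated over `I`: every pair of `I`-positive subsets is weakly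
`(i,j)`-saturated over `I`. -/
def Sat {H : Type u} {X : Type v} {K : ℕ} (c : Sym2 X → Fin K)
    (I : Set (Set (Set H))) (F : Set H → X) (A B : Set (Set H)) (i j : Fin K) : Prop :=
  ∀ C, C ⊆ A → C ∈ pos H I → ∀ D, D ⊆ B → D ∈ pos H I → WeaklySat c I F C D i j

/-- `(A, B)` is `P`-unsaturated over `I`: for no `(i,j) ∈ P` is `(A,B)` weakly
`(i,j)`-saturated over `I`. -/
def Unsat {H : Type u} {X : Type v} {K : ℕ} (c : Sym2 X → Fin K)
    (I : Set (Set (Set H))) (F : Set H → X) (A B : Set (Set H))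
    (P : Set (Fin K × Fin K)) : Prop :=
  ∀ p ∈ P, ¬ WeaklySat c I F A B p.1 p.2

end Galvin
namespace Galvin

/-- A club in `P_{ω₁}(H)`: a cofinal collection of countable subsets of `H` closed under
unions of nonempty countable `⊆`-chains. -/
def IsClub (H : Type u) (C : Set (Set H)) : Prop :=
  C ⊆ Pom H ∧ (∀ N ∈ Pom H, ∃ M ∈ C, N ⊆ M) ∧
    ∀ D : Set (Set H), D ⊆ C → D.Nonempty → D.Countable → IsChain (· ⊆ ·) D → ⋃₀ D ∈ C

/-- A stationary subset of `P_{ω₁}(H)`: one meeting every club. -/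
def IsStationary (H : Type u) (S : Set (Set H)) : Prop :=
  S ⊆ Pom H ∧ ∀ C : Set (Set H), IsClub H C → (S ∩ C).Nonempty

end Galvin

namespace Galvin

/-- `M` is closed under the set mapping `f` on finite sets. -/
def ClosedUnder {H : Type u} (f : Finset H → Set H) (M : Set H) : Prop :=
  ∀ s : Finset H, (s : Set H) ⊆ M → f s ⊆ M

/-- The ideal of sets of countable `M` none of which is closed under some fixed countable-valued
set mapping on finite sets; this is the nonstationary ideal. -/
def nonstat (H : Type u) : Set (Set (Set H)) :=
  {A | A ⊆ Pom H ∧ ∃ f : Finset H → Set H, (∀ s, (f s).Countable) ∧ ∀ M ∈ A, ¬ ClosedUnder f M}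

theorem ClosedUnder.mono {H : Type u} {f g : Finset H → Set H} {M : Set H}
    (h : ClosedUnder g M) (hfg : ∀ s, f s ⊆ g s) : ClosedUnder f M :=
  fun s hs => (hfg s).trans (h s hs)

theorem isClub_closedUnder {H : Type u} {f : Finset H → Set H} (hf : ∀ s, (f s).Countable) :
    IsClub H {M ∈ Pom H | ClosedUnder f M} := by
  refine ⟨fun M hM => hM.1, fun N hN => ?_, fun D hD hne hc hchain => ⟨?_, ?_⟩⟩
  · let step : Set H → Set H := fun M => M ∪ ⋃ s ∈ {s : Finset H | (s : Set H) ⊆ M}, f s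
    let G : ℕ → Set H := fun n => step^[n] N
    have hsucc (n : ℕ) : G (n + 1) = step (G n) := Function.iterate_succ_apply' step n N
    have hmono : Monotone G := monotone_nat_of_le_succ fun n => by
      rw [hsucc]; exact Set.subset_union_left
    have hcount (n : ℕ) : (G n).Countable := by
      induction n with
      | zero => exact hN
      | succ n ih =>
        rw [hsucc]
        refine ih.union (Set.Countable.biUnion ?_ fun s _ => hf s)
        refine Set.MapsTo.countable_of_injOn (f := fun s : Finset H => (s : Set H))
          (t := {t : Set H | t.Finite ∧ t ⊆ G n}) (fun s hs => ⟨s.finite_toSet, hs⟩)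
          (Finset.coe_injective.injOn) (Set.countable_ofPred_finite_subset ih)
    refine ⟨⋃ n, G n, ⟨Set.countable_iUnion hcount, fun s hs => ?_⟩, Set.subset_iUnion G 0⟩
    obtain ⟨n, hn⟩ := hmono.directed_le.exists_mem_subset_of_finset_subset_biUnion hs
    intro x hx
    refine Set.mem_iUnion.2 ⟨n + 1, ?_⟩
    rw [hsucc]
    exact Or.inr (Set.mem_biUnion (show s ∈ {s : Finset H | (s : Set H) ⊆ G n} from hn) hx)
  · exact hc.sUnion fun M hM => (hD hM).1
  · intro s hs
    obtain ⟨M, hM, hsM⟩ := hchain.directedOn.exists_mem_subset_of_finite_of_subset_sUnion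
      hne s.finite_toSet hs
    exact ((hD hM).2 s hsM).trans (Set.subset_sUnion_of_mem hM)

theorem IsStationary.notMem_nonstat {H : Type u} {S : Set (Set H)} (hS : IsStationary H S) :
    S ∉ nonstat H := by
  rintro ⟨-, f, hf, hfS⟩
  obtain ⟨M, hMS, -, hM⟩ := hS.2 _ (isClub_closedUnder hf)
  exact hfS M hMS hM

theorem nonstat_subset_mem {H : Type u} {A B : Set (Set H)} (hA : A ∈ nonstat H) (hBA : B ⊆ A) :
    B ∈ nonstat H :=
  ⟨hBA.trans hA.1, hA.2.imp fun _ hf => ⟨hf.1, fun M hM => hf.2 M (hBA hM)⟩⟩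

theorem isComplete_nonstat (H : Type u) : IsComplete (nonstat H) := by
  intro A hA
  choose hA f hf hfA using hA
  refine ⟨Set.iUnion_subset hA, fun s => ⋃ n, f n s, fun s => Set.countable_iUnion fun n => hf n s,
    fun M hM hcl => ?_⟩
  obtain ⟨n, hn⟩ := Set.mem_iUnion.1 hM
  exact hfA n M hn (hcl.mono fun s => Set.subset_iUnion (fun n => f n s) n)

theorem isFineIdeal_nonstat {H : Type u} {S : Set (Set H)} (hS : IsStationary H S) :
    IsFineIdeal H (nonstat H) := by
  refine ⟨⟨fun A hA => hA.1, ⟨Set.empty_subset _, fun _ => ∅, by simp, by simp⟩,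
    fun A hA B hBA => nonstat_subset_mem hA hBA, ?_,
    fun h => hS.notMem_nonstat (nonstat_subset_mem h hS.1)⟩, isComplete_nonstat H, fun x => ?_⟩
  · rintro A ⟨hA, f, hf, hfA⟩ B ⟨hB, g, hg, hgB⟩
    refine ⟨Set.union_subset hA hB, fun s => f s ∪ g s, fun s => (hf s).union (hg s), ?_⟩
    rintro M (hM | hM) hcl
    · exact hfA M hM (hcl.mono fun s => Set.subset_union_left)
    · exact hgB M hM (hcl.mono fun s => Set.subset_union_right)
  · refine ⟨fun M hM => hM.1, fun _ => {x}, fun _ => Set.countable_singleton x, ?_⟩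
    exact fun M hM hcl => hM.2 (hcl ∅ (by simp) rfl)

theorem isNormal_nonstat (H : Type u) : IsNormal H (nonstat H) := by
  classical
  intro A hA
  choose hA f hf hfA using hA
  refine ⟨fun M hM => hM.1, fun s => ⋃ x ∈ s, ⋃ t ∈ s.powerset, f x t, fun s => ?_, ?_⟩
  · exact s.countable_toSet.biUnion fun x _ =>
      s.powerset.countable_toSet.biUnion fun t _ => hf x t
  · rintro M ⟨-, x, hxM, hMx⟩ hcl
    refine hfA x M hMx fun t ht z hz => hcl (insert x t) ?_ ?_
    · simpa [Set.insert_subset_iff] using ⟨hxM, ht⟩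
    · simp only [Set.mem_iUnion]
      exact ⟨x, Finset.mem_insert_self x t, t,
        Finset.mem_powerset.2 (Finset.subset_insert x t), hz⟩

section Saturation

variable {H : Type u} {J : Set (Set (Set H))}

theorem eIdeal_iff {A : Set (Set H)} (hA : A ⊆ Pom H) (φ : Set H → Prop) :
    eIdeal J A φ ↔ {M ∈ A | φ M} ∉ J := by
  have h : {M ∈ A | φ M} ∩ A = {M ∈ A | φ M} := Set.inter_eq_left.2 fun M hM => hM.1
  have h' : {M ∈ A | φ M} ⊆ Pom H := fun M hM => hA hM.1
  simp [eIdeal, pos, add, h, h']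

theorem eIdeal.mono (hJ : IsIdeal H J) {A B : Set (Set H)} {φ ψ : Set H → Prop}
    (h : eIdeal J A φ) (hA : A ⊆ Pom H) (hB : B ⊆ Pom H) (hAB : A ⊆ B) (hφ : ∀ M, φ M → ψ M) :
    eIdeal J B ψ := by
  rw [eIdeal_iff hA] at h
  rw [eIdeal_iff hB]
  exact fun hm => h (hJ.subset_mem _ hm _ fun M hM => ⟨hAB hM.1, hφ M hM.2⟩)

/-- If a positive set is covered, up to a null set, by countably many pieces, then one of
the pieces is positive. -/
theorem exists_eIdeal (hJ : IsFineIdeal H J) {ι : Type*} [Countable ι] {A : Set (Set H)}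
    (hA : A ∈ pos H J) {E : Set (Set H)} (hE : E ∈ J) {φ : ι → Set H → Prop}
    (h : ∀ M ∈ A, M ∉ E → ∃ i, φ i M) : ∃ i, eIdeal J A (φ i) := by
  by_contra! hn
  simp only [eIdeal_iff hA.1, not_not] at hn
  have hU : (⋃ i, {M ∈ A | φ i M}) ∈ J := by
    rcases isEmpty_or_nonempty ι with hι | hι
    · simpa using hJ.1.empty_mem
    · obtain ⟨e, he⟩ := exists_surjective_nat ι
      rw [← he.iUnion_comp]
      exact hJ.2.1 _ fun n => hn (e n)
  refine hA.2 (hJ.1.subset_mem _ (hJ.1.union_mem _ hE _ hU) _ fun M hM => ?_)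
  by_cases hME : M ∈ E
  · exact Or.inl hME
  · obtain ⟨i, hi⟩ := h M hM hME
    exact Or.inr (Set.mem_iUnion.2 ⟨i, hM, hi⟩)

variable {K : ℕ} {c : Sym2 H → Fin K} {F : Set H → H}

theorem WeaklySat.mono (hJ : IsIdeal H J) {A B C D : Set (Set H)} {i j : Fin K}
    (h : WeaklySat c J F C D i j) (hA : A ⊆ Pom H) (hB : B ⊆ Pom H) (hCA : C ⊆ A) (hDB : D ⊆ B) :
    WeaklySat c J F A B i j :=
  ⟨h.1.mono hJ (hCA.trans hA) hA hCA fun _ hM => hM.mono hJ (hDB.trans hB) hB hDB fun _ => id,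
    h.2.mono hJ (hDB.trans hB) hB hDB fun _ hN => hN.mono hJ (hCA.trans hA) hA hCA fun _ => id⟩

/-- Every pair of positive sets of models omitting their own `F`-value is weakly saturated for
some pair of colours in the first coordinate. -/
theorem exists_eIdeal_eIdeal (hJ : IsFineIdeal H J) {C D : Set (Set H)} (hC : C ∈ pos H J)
    (hD : D ∈ pos H J) (hF : ∀ N ∈ D, F N ∉ N) :
    ∃ i, eIdeal J C fun M => eIdeal J D fun N => F M ≠ F N ∧ c s(F M, F N) = i := by
  refine exists_eIdeal hJ hC hJ.1.empty_mem fun M _ _ => ?_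
  refine exists_eIdeal hJ hD (hJ.2.2 (F M)) fun N hN hNE => ⟨_, ?_, rfl⟩
  rintro heq
  exact hNE ⟨hD.1 hN, heq ▸ hF N hN⟩

theorem exists_weaklySat (hJ : IsFineIdeal H J) {C D : Set (Set H)} (hC : C ∈ pos H J)
    (hD : D ∈ pos H J) (hFC : ∀ M ∈ C, F M ∉ M) (hFD : ∀ N ∈ D, F N ∉ N) :
    ∃ i j, WeaklySat c J F C D i j := by
  obtain ⟨i, hi⟩ := exists_eIdeal_eIdeal (c := c) hJ hC hD hFD
  obtain ⟨j, hj⟩ := exists_eIdeal_eIdeal (c := c) hJ hD hC hFC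
  refine ⟨i, j, hi, ?_⟩
  simpa only [ne_comm, Sym2.eq_swap] using hj

end Saturation

/-- Below every positive subset of `A` over every fine normal ideal extending `I`, some pair of
positive subsets is `P`-unsaturated over a further extension. -/
def DenselyUnsat {H : Type u} {K : ℕ} (c : Sym2 H → Fin K) (F : Set H → H)
    (I : Set (Set (Set H))) (A : Set (Set H)) (P : Set (Fin K × Fin K)) : Prop :=
  ∀ J₀ : Set (Set (Set H)), IsFineIdeal H J₀ → IsNormal H J₀ → I ⊆ J₀ →
    ∀ B, B ⊆ A → B ∈ pos H J₀ →
      ∃ J₁ : Set (Set (Set H)), IsFineIdeal H J₁ ∧ IsNormal H J₁ ∧ J₀ ⊆ J₁ ∧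
        ∃ C, C ⊆ B ∧ C ∈ pos H J₁ ∧ ∃ D, D ⊆ B ∧ D ∈ pos H J₁ ∧ Unsat c J₁ F C D P

/-- Lemma 6.5: there are a fine normal ideal `I`, an `I`-positive `A ⊆ Λ`, a proper subset
`P ⊊ K × K` and a pair `(i,j) ∉ P` such that: (1) for every fine normal `J ⊇ I` and
`J`-positive `C, D ⊆ A`, if `(C,D)` is `P`-unsaturated over `J` then it is `(i,j)`-saturated
over `J`; and (2) below every `J₀`-positive `B ⊆ A` (for fine normal `J₀ ⊇ I`) some pair of
positive subsets is `P`-unsaturated over some fine normal `J₁ ⊇ J₀`. -/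
theorem exists_decisive_data {H : Type u} (K : ℕ) (hK : 0 < K)
    (c : Sym2 H → Fin K)
    (Λ : Set (Set H)) (hΛ : IsStationary H Λ)
    (F : Set H → H) (hF : ∀ M ∈ Λ, F M ∉ M) :
    ∃ I : Set (Set (Set H)), IsFineIdeal H I ∧ IsNormal H I ∧
      ∃ A ⊆ Λ, A ∈ pos H I ∧
        ∃ P : Set (Fin K × Fin K), P ≠ Set.univ ∧
          ∃ i j : Fin K, (i, j) ∉ P ∧
            (∀ J : Set (Set (Set H)), IsFineIdeal H J → IsNormal H J → I ⊆ J →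
              ∀ C, C ⊆ A → C ∈ pos H J → ∀ D, D ⊆ A → D ∈ pos H J →
                Unsat c J F C D P → Sat c J F C D i j) ∧
            (∀ J₀ : Set (Set (Set H)), IsFineIdeal H J₀ → IsNormal H J₀ → I ⊆ J₀ →
              ∀ B, B ⊆ A → B ∈ pos H J₀ →
                ∃ J₁ : Set (Set (Set H)), IsFineIdeal H J₁ ∧ IsNormal H J₁ ∧ J₀ ⊆ J₁ ∧
                  ∃ C, C ⊆ B ∧ C ∈ pos H J₁ ∧ ∃ D, D ⊆ B ∧ D ∈ pos H J₁ ∧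
                    Unsat c J₁ F C D P) := by
  let good : Set (Set (Fin K × Fin K)) := {P | ∃ I, IsFineIdeal H I ∧ IsNormal H I ∧
    ∃ A ⊆ Λ, A ∈ pos H I ∧ DenselyUnsat c F I A P}
  have hgood : (∅ : Set (Fin K × Fin K)) ∈ good :=
    ⟨nonstat H, isFineIdeal_nonstat hΛ, isNormal_nonstat H, Λ, subset_rfl,
      ⟨hΛ.1, hΛ.notMem_nonstat⟩, fun J hJ hJn _ B _ hB =>
        ⟨J, hJ, hJn, subset_rfl, B, subset_rfl, hB, B, subset_rfl, hB, fun p hp => hp.elim⟩⟩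
  obtain ⟨P, ⟨I, hI, hIn, A, hAΛ, hA, hdense⟩, hmax⟩ :=
    (Set.toFinite good).exists_maximal ⟨_, hgood⟩
  have hP : P ≠ Set.univ := by
    rintro rfl
    obtain ⟨J, hJ, -, -, C, hCA, hC, D, hDA, hD, hunsat⟩ :=
      hdense I hI hIn subset_rfl A subset_rfl hA
    obtain ⟨i, j, hij⟩ := exists_weaklySat (c := c) hJ hC hD
      (fun M hM => hF M (hAΛ (hCA hM))) (fun M hM => hF M (hAΛ (hDA hM)))
    exact hunsat (i, j) trivial hij
  obtain ⟨⟨i, j⟩, hij⟩ := (Set.ne_univ_iff_exists_notMem P).1 hP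
  by_contra hcon
  refine hij (hmax (y := insert (i, j) P)
    ⟨I, hI, hIn, A, hAΛ, hA, fun J₀ hJ₀ hJ₀n hIJ B hBA hB => ?_⟩
    (Set.subset_insert _ _) (Set.mem_insert _ _))
  by_contra hno
  refine hcon ⟨J₀, hJ₀, hJ₀n, B, hBA.trans hAΛ, hB, P, hP, i, j, hij, ?_,
    fun J hJ hJn hJJ E hE => hdense J hJ hJn (hIJ.trans hJJ) E (hE.trans hBA)⟩
  intro J hJ hJn hJJ C hCB hC D hDB hD hunsat C' hCC hC' D' hDD hD'
  by_contra hweak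
  refine hno ⟨J, hJ, hJn, hJJ, C', hCC.trans hCB, hC', D', hDD.trans hDB, hD', ?_⟩
  rintro p (rfl | hp) hsat
  · exact hweak hsat
  · exact hunsat p hp (hsat.mono hJ.1 hC.1 hD.1 hCC hDD)

end Galvin
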